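/- arXiv:2101.00077 — 5 statements merged into one kernel-verified Lean document; each statement's English description precedes it below -/
import Mathlib

section
/- If a morphism f : G → H of globular sets is surjective on 0-cells and full, then f is a split epimorphism: there exists a morphism f' : H → G of globular sets such that f_n ∘ f'_n = id_{H_n} for every n ∈ ℕ. -/
/-- A globular set: sets of `n`-cells for each `n`, with source and target maps
satisfying the globular identities. -/
structure GlobSet : Type 1 where
  cell : ℕ → Type
  src : ∀ n, cell (n + 1) → cell n
  tgt : ∀ n, cell (n + 1) → cell n
  src_src : ∀ n (x : cell (n + 2)), src n (src (n + 1) x) = src n (tgt (n + 1) x)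
  tgt_tgt : ∀ n (x : cell (n + 2)), tgt n (src (n + 1) x) = tgt n (tgt (n + 1) x)

/-- A morphism of globular sets: a family of maps commuting with sources and targets. -/
structure GlobMap (G H : GlobSet) where
  app : ∀ n, G.cell n → H.cell n
  comm_src : ∀ n (x : G.cell (n + 1)), app n (G.src n x) = H.src n (app (n + 1) x)
  comm_tgt : ∀ n (x : G.cell (n + 1)), app n (G.tgt n x) = H.tgt n (app (n + 1) x)

/-- Two `n`-cells are parallel if they have the same source and target;
all pairs of `0`-cells are parallel. -/
def GlobSet.Parallel (G : GlobSet) : ∀ n, G.cell n → G.cell n → Prop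
  | 0, _, _ => True
  | n + 1, x, x' => G.src n x = G.src n x' ∧ G.tgt n x = G.tgt n x'

/-- A morphism of globular sets is full if it is `k`-full for every `k ≥ 1`:
for every parallel pair `(x, x')` of `(k-1)`-cells, every `k`-cell of `H` from
`f x` to `f x'` is the image of a `k`-cell of `G` from `x` to `x'`. -/
def GlobMap.IsFull {G H : GlobSet} (f : GlobMap G H) : Prop :=
  ∀ (k : ℕ) (x x' : G.cell k), G.Parallel k x x' →
    ∀ ψ : H.cell (k + 1), H.src k ψ = f.app k x → H.tgt k ψ = f.app k x' →
      ∃ χ : G.cell (k + 1), G.src k χ = x ∧ G.tgt k χ = x' ∧ f.app (k + 1) χ = ψ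

/-- The source and target of a cell are parallel. -/
theorem GlobSet.parallel_src_tgt (G : GlobSet) :
    ∀ n (x : G.cell (n + 1)), G.Parallel n (G.src n x) (G.tgt n x)
  | 0, _ => trivial
  | n + 1, x => ⟨G.src_src n x, G.tgt_tgt n x⟩

/-- A section of `f` on `n`-cells that preserves parallel pairs. -/
structure GlobMap.LevelSection {G H : GlobSet} (f : GlobMap G H) (n : ℕ) where
  app : H.cell n → G.cell n
  right_inv : ∀ y, f.app n (app y) = y
  parallel : ∀ y y', H.Parallel n y y' → G.Parallel n (app y) (app y')

/-- Along a full morphism, a section on `n`-cells extends to `(n + 1)`-cells. -/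
theorem GlobMap.IsFull.exists_extension {G H : GlobSet} {f : GlobMap G H} (hfull : f.IsFull)
    {n : ℕ} (g : f.LevelSection n) :
    ∃ g' : f.LevelSection (n + 1), ∀ y,
      G.src n (g'.app y) = g.app (H.src n y) ∧ G.tgt n (g'.app y) = g.app (H.tgt n y) := by
  choose χ hs ht hχ using fun y : H.cell (n + 1) =>
    hfull n _ _ (g.parallel _ _ (H.parallel_src_tgt n y)) y
      (g.right_inv _).symm (g.right_inv _).symm
  refine ⟨⟨χ, hχ, fun y y' h => ⟨?_, ?_⟩⟩, fun y => ⟨hs y, ht y⟩⟩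
  · rw [hs, hs, h.1]
  · rw [ht, ht, h.2]

/-- If a morphism of globular sets is surjective on 0-cells and full,
then it is a split epimorphism. -/
theorem stmt0 {G H : GlobSet} (f : GlobMap G H)
    (h0 : Function.Surjective (f.app 0)) (hfull : f.IsFull) :
    ∃ f' : GlobMap H G, ∀ n, f.app n ∘ f'.app n = id := by
  choose g₀ hg₀ using h0
  choose next hnext using fun (n : ℕ) (g : f.LevelSection n) => hfull.exists_extension g
  let g : ∀ n, f.LevelSection n :=
    fun n => Nat.rec ⟨g₀, hg₀, fun _ _ _ => trivial⟩ next n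
  exact ⟨⟨fun n => (g n).app, fun n x => (hnext n (g n) x).1.symm,
    fun n x => (hnext n (g n) x).2.symm⟩, fun n => funext (g n).right_inv⟩
end

section
/- Fix n ≥ 1. Let T be an n-globular set in which every cell of positive dimension has equal source and target, and let g : G → T and h : H → T be morphisms of n-globular sets such that any parallel pair of n-cells of H with the same image under h are equal. If f, f' : G → H are morphisms of n-globular sets with h ∘ f = g = h ∘ f' and f_k = f'_k for all 0 ≤ k < n, then f_n = f'_n, and hence f = f'. (This is the statement that a morphism of n-globular operads into an operad satisfying the n-dimensional uniqueness condition of contractibility is completely determined by its values in dimensions below n.) -/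
/-- An `n`-globular set: sets of `k`-cells for `0 ≤ k ≤ n`, with source and target
maps satisfying the globular identities.  (Cells in dimensions above `n` play no
role in any definition below.) -/
structure NGlob (n : ℕ) : Type 1 where
  cell : ℕ → Type
  src : ∀ k, k < n → cell (k + 1) → cell k
  tgt : ∀ k, k < n → cell (k + 1) → cell k
  src_src : ∀ k (h : k + 1 < n) (x : cell (k + 2)),
    src k (Nat.lt_of_succ_lt h) (src (k + 1) h x) =
      src k (Nat.lt_of_succ_lt h) (tgt (k + 1) h x)
  tgt_tgt : ∀ k (h : k + 1 < n) (x : cell (k + 2)),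
    tgt k (Nat.lt_of_succ_lt h) (src (k + 1) h x) =
      tgt k (Nat.lt_of_succ_lt h) (tgt (k + 1) h x)

/-- A morphism of `n`-globular sets: a family of maps in dimensions `0,…,n`
commuting with sources and targets. -/
structure NGlobMap {n : ℕ} (G H : NGlob n) where
  app : ∀ k, k ≤ n → G.cell k → H.cell k
  comm_src : ∀ k (h : k < n) (x : G.cell (k + 1)),
    app k (Nat.le_of_lt h) (G.src k h x) = H.src k h (app (k + 1) h x)
  comm_tgt : ∀ k (h : k < n) (x : G.cell (k + 1)),
    app k (Nat.le_of_lt h) (G.tgt k h x) = H.tgt k h (app (k + 1) h x)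

/-- Two `k`-cells are parallel if they have the same source and target;
all pairs of `0`-cells are parallel. -/
def NGlob.Parallel {n : ℕ} (G : NGlob n) : ∀ k, k ≤ n → G.cell k → G.cell k → Prop
  | 0, _, _, _ => True
  | k + 1, h, x, x' => G.src k h x = G.src k h x' ∧ G.tgt k h x = G.tgt k h x'

/-- `f` is `(k+1)`-full: for every parallel pair `(x, x')` of `k`-cells of `G`,
every `(k+1)`-cell of `H` from `f x` to `f x'` is the image of a `(k+1)`-cell of
`G` from `x` to `x'`. -/
def NGlobMap.KFull {n : ℕ} {G H : NGlob n} (f : NGlobMap G H) (k : ℕ) (h : k < n) : Prop :=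
  ∀ x x' : G.cell k, G.Parallel k (Nat.le_of_lt h) x x' →
    ∀ ψ : H.cell (k + 1), H.src k h ψ = f.app k (Nat.le_of_lt h) x →
      H.tgt k h ψ = f.app k (Nat.le_of_lt h) x' →
        ∃ χ : G.cell (k + 1), G.src k h χ = x ∧ G.tgt k h χ = x' ∧ f.app (k + 1) h χ = ψ

/-- `f` is full: `k`-full for every `1 ≤ k ≤ n`. -/
def NGlobMap.Full {n : ℕ} {G H : NGlob n} (f : NGlobMap G H) : Prop :=
  ∀ k (h : k < n), f.KFull k h

/-- `f` is `(k+1)`-faithful: for every parallel pair of `(k+1)`-cells of `G`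
(having the same source and the same target), equal images under `f` imply
the cells are equal. -/
def NGlobMap.KFaithful {n : ℕ} {G H : NGlob n} (f : NGlobMap G H) (k : ℕ) (h : k < n) : Prop :=
  ∀ χ χ' : G.cell (k + 1), G.src k h χ = G.src k h χ' → G.tgt k h χ = G.tgt k h χ' →
    f.app (k + 1) h χ = f.app (k + 1) h χ' → χ = χ'

/-- For `n ≥ 1` (here the paper's `n` is `n + 1`): let `T` be an `(n+1)`-globular
set whose positive-dimensional cells have equal source and target, and let
`g : G → T`, `h : H → T` be morphisms such that parallel top cells of `H` with the
same image under `h` are equal.  If `f, f' : G → H` satisfy `h ∘ f = g = h ∘ f'`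
and agree in all dimensions below the top, then they agree in the top dimension,
and hence everywhere. -/
theorem stmt4 (n : ℕ) {G H T : NGlob (n + 1)}
    (hT : ∀ k (hk : k < n + 1) (τ : T.cell (k + 1)), T.src k hk τ = T.tgt k hk τ)
    (g : NGlobMap G T) (h : NGlobMap H T)
    (hH : h.KFaithful n (Nat.lt_succ_self n))
    (f f' : NGlobMap G H)
    (hf : ∀ k (hk : k ≤ n + 1) (x : G.cell k), h.app k hk (f.app k hk x) = g.app k hk x)
    (hf' : ∀ k (hk : k ≤ n + 1) (x : G.cell k), h.app k hk (f'.app k hk x) = g.app k hk x)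
    (hlow : ∀ k (hk : k < n + 1) (x : G.cell k),
      f.app k (Nat.le_of_lt hk) x = f'.app k (Nat.le_of_lt hk) x) :
    (∀ x : G.cell (n + 1),
        f.app (n + 1) (Nat.le_refl (n + 1)) x = f'.app (n + 1) (Nat.le_refl (n + 1)) x) ∧
      (∀ k (hk : k ≤ n + 1) (x : G.cell k), f.app k hk x = f'.app k hk x) := by
  have htop : ∀ x : G.cell (n + 1),
      f.app (n + 1) (Nat.le_refl (n + 1)) x = f'.app (n + 1) (Nat.le_refl (n + 1)) x := by
    intro x
    apply hH
    · rw [← f.comm_src, ← f'.comm_src, hlow n n.lt_succ_self]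
    · rw [← f.comm_tgt, ← f'.comm_tgt, hlow n n.lt_succ_self]
    · rw [hf, hf']
  refine ⟨htop, fun k hk x => ?_⟩
  obtain hlt | rfl := Nat.lt_or_eq_of_le hk
  · exact hlow k hlt x
  · exact htop x
end

section
/- Fix n ≥ 1. Let T be an n-globular set in which every cell of positive dimension has equal source and target (write ∂τ for the common source/target), and let g : G → T and h : H → T be morphisms of n-globular sets. Assume: (a) for every triple (x, x', τ), where (x, x') is a parallel pair of (n−1)-cells of G and τ is an n-cell of T with g(x) = g(x') = ∂τ, there exists an n-cell χ of G with s(χ) = x, t(χ) = x' and g(χ) = τ; (b) any parallel pair of n-cells of G with the same image under g are equal; and (c) any parallel pair of n-cells of H with the same image under h are equal. Then every morphism f : G → H of n-globular sets with h ∘ f = g is n-full and n-faithful. -/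
/-- For `n ≥ 1` (here the paper's `n` is `n + 1`): let `T` be an `(n+1)`-globular
set whose positive-dimensional cells have equal source and target, and let
`g : G → T`, `h : H → T` be morphisms such that: (a) over every triple `(x, x', τ)`
of a parallel pair of top-boundary cells of `G` and a top cell of `T` with
`g x = g x' = ∂τ` there is a top cell of `G`; (b) parallel top cells of `G` with
the same image under `g` are equal; (c) parallel top cells of `H` with the same
image under `h` are equal.  Then every morphism `f : G → H` with `h ∘ f = g` is
full and faithful in the top dimension. -/
theorem stmt5 (n : ℕ) {G H T : NGlob (n + 1)}
    (hT : ∀ k (hk : k < n + 1) (τ : T.cell (k + 1)), T.src k hk τ = T.tgt k hk τ)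
    (g : NGlobMap G T) (h : NGlobMap H T)
    (ha : ∀ x x' : G.cell n, G.Parallel n (Nat.le_succ n) x x' →
      ∀ τ : T.cell (n + 1), g.app n (Nat.le_succ n) x = T.src n (Nat.lt_succ_self n) τ →
        g.app n (Nat.le_succ n) x' = T.src n (Nat.lt_succ_self n) τ →
          ∃ χ : G.cell (n + 1), G.src n (Nat.lt_succ_self n) χ = x ∧
            G.tgt n (Nat.lt_succ_self n) χ = x' ∧
            g.app (n + 1) (Nat.le_refl (n + 1)) χ = τ)
    (hb : g.KFaithful n (Nat.lt_succ_self n))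
    (hc : h.KFaithful n (Nat.lt_succ_self n))
    (f : NGlobMap G H)
    (hf : ∀ k (hk : k ≤ n + 1) (x : G.cell k), h.app k hk (f.app k hk x) = g.app k hk x) :
    f.KFull n (Nat.lt_succ_self n) ∧ f.KFaithful n (Nat.lt_succ_self n) := by
  refine ⟨fun x x' hp ψ hs ht => ?_, fun χ χ' hs ht he => hb χ χ' hs ht ?_⟩
  · obtain ⟨χ, hχs, hχt, hχ⟩ := ha x x' hp (h.app (n + 1) le_rfl ψ)
      (by rw [← hf, ← hs, h.comm_src])
      (by rw [← hf, ← ht, h.comm_tgt, hT])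
    refine ⟨χ, hχs, hχt, hc _ _ ?_ ?_ ?_⟩
    · rw [← f.comm_src, hχs, hs]
    · rw [← f.comm_tgt, hχt, ht]
    · rw [hf, hχ]
  · rw [← hf, ← hf, he]
end

section
/- Let T be a globular set in which every cell of positive dimension has equal source and target. Let i : I → T be a full morphism of globular sets, let g : G → T be a morphism of globular sets, and let u : I → G be a morphism of globular sets with g ∘ u = i. If u is surjective on 0-cells and full, then g is full. (This is the statement that if a globular operad G admits a morphism from the initial globular operad with contraction I that is surjective on 0-cells and full on underlying globular sets, then G is contractible.) -/
/-- Parallel pairs lift to parallel pairs along a full morphism that is surjective on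
`0`-cells. -/
theorem GlobMap.IsFull.exists_parallel_lift {G H : GlobSet} {f : GlobMap G H}
    (hf : f.IsFull) (hf0 : Function.Surjective (f.app 0)) :
    ∀ n (x x' : H.cell n), H.Parallel n x x' →
      ∃ y y' : G.cell n, G.Parallel n y y' ∧ f.app n y = x ∧ f.app n y' = x' := by
  intro n
  induction n with
  | zero =>
    intro x x' _
    obtain ⟨y, rfl⟩ := hf0 x
    obtain ⟨y', rfl⟩ := hf0 x'
    exact ⟨y, y', trivial, rfl, rfl⟩
  | succ n ih =>
    rintro x x' ⟨hs, ht⟩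
    obtain ⟨c, d, hcd, hc, hd⟩ := ih _ _ (H.parallel_src_tgt n x)
    obtain ⟨y, hys, hyt, hy⟩ := hf n c d hcd x hc.symm hd.symm
    obtain ⟨y', hys', hyt', hy'⟩ :=
      hf n c d hcd x' (hs.symm.trans hc.symm) (ht.symm.trans hd.symm)
    exact ⟨y, y', ⟨hys.trans hys'.symm, hyt.trans hyt'.symm⟩, hy, hy'⟩

/-- Let `T` be a globular set in which every cell of positive dimension has equal
source and target, `i : I → T` a full morphism, `g : G → T` a morphism, and
`u : I → G` a morphism with `g ∘ u = i`.  If `u` is surjective on `0`-cells and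
full, then `g` is full. -/
theorem stmt6 {I T G : GlobSet}
    (hT : ∀ n (τ : T.cell (n + 1)), T.src n τ = T.tgt n τ)
    (i : GlobMap I T) (hi : i.IsFull)
    (g : GlobMap G T) (u : GlobMap I G)
    (hcomm : ∀ n (x : I.cell n), g.app n (u.app n x) = i.app n x)
    (hu0 : Function.Surjective (u.app 0)) (hufull : u.IsFull) :
    g.IsFull := by
  intro k x x' hx ψ hs ht
  obtain ⟨y, y', hy, rfl, rfl⟩ := hufull.exists_parallel_lift hu0 k x x' hx
  obtain ⟨χ, rfl, rfl, rfl⟩ := hi k y y' hy ψ (hs.trans (hcomm k y)) (ht.trans (hcomm k y'))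
  exact ⟨u.app (k + 1) χ, (u.comm_src k χ).symm, (u.comm_tgt k χ).symm, hcomm (k + 1) χ⟩
end

section
/- Let C be a complete and cocomplete category and let T be a monad on C whose underlying endofunctor preserves filtered colimits (i.e., T is finitary). Then the Eilenberg–Moore category of T-algebras is complete and cocomplete. -/
open CategoryTheory CategoryTheory.Limits

namespace CategoryTheory.Monad

universe v u

variable {C : Type u} [Category.{v} C] {T : Monad C}

/-- A partial algebra for a monad `T`: an action `T X ⟶ Y` with values in another object. -/
structure PartialAlgebra (T : Monad C) where
  /-- The object on which `T` acts. -/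
  source : C
  /-- The object in which the action takes its values. -/
  target : C
  /-- The action. -/
  act : T.obj source ⟶ target

namespace PartialAlgebra

/-- The comparison from the source to the target of a partial algebra. -/
def unit (P : PartialAlgebra T) : P.source ⟶ P.target :=
  T.η.app P.source ≫ P.act

/-- A morphism from a partial algebra to an algebra. -/
structure Hom (P : PartialAlgebra T) (B : T.Algebra) where
  /-- The morphism on the source. -/
  onSource : P.source ⟶ B.A
  /-- The morphism on the target. -/
  onTarget : P.target ⟶ B.A
  act_onTarget : P.act ≫ onTarget = T.map onSource ≫ B.a

lemma Hom.unit_onTarget {P : PartialAlgebra T} {B : T.Algebra} (φ : P.Hom B) :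
    P.unit ≫ φ.onTarget = φ.onSource := by
  rw [unit, Category.assoc, φ.act_onTarget, ← T.unit_naturality_assoc, B.unit, Category.comp_id]

section Next

variable [HasCoequalizers C]

/-- The quotient of `T P.target` which makes the action of `P` associative. -/
noncomputable def nextTarget (P : PartialAlgebra T) : C :=
  coequalizer (T.map P.act) (T.μ.app P.source ≫ T.map P.unit)

/-- The projection to `P.nextTarget`. -/
noncomputable def nextAct (P : PartialAlgebra T) : T.obj P.target ⟶ P.nextTarget :=
  coequalizer.π _ _

instance (P : PartialAlgebra T) : Epi P.nextAct :=
  coequalizer.π_epi (f := T.map P.act) (g := T.μ.app P.source ≫ T.map P.unit)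

/-- The next partial algebra in the free algebra sequence: it acts on the target of `P`, with
values in the quotient which makes this action associative. -/
noncomputable abbrev next (P : PartialAlgebra T) : PartialAlgebra T where
  source := P.target
  target := P.nextTarget
  act := P.nextAct

lemma map_act_nextAct (P : PartialAlgebra T) :
    T.map P.act ≫ P.nextAct = T.μ.app P.source ≫ T.map P.unit ≫ P.nextAct :=
  (coequalizer.condition _ _).trans (Category.assoc _ _ _)

lemma map_unit_nextAct (P : PartialAlgebra T) :
    T.map P.unit ≫ P.nextAct = P.act ≫ P.next.unit := by
  have h := T.η.app (T.obj P.source) ≫= P.map_act_nextAct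
  rw [T.left_unit_assoc] at h
  exact h.symm.trans (T.η.naturality_assoc P.act P.nextAct).symm

/-- A morphism from a partial algebra to an algebra extends to the next partial algebra. -/
noncomputable def Hom.next {P : PartialAlgebra T} {B : T.Algebra} (φ : P.Hom B) :
    P.next.Hom B where
  onSource := φ.onTarget
  onTarget := coequalizer.desc (T.map φ.onTarget ≫ B.a) (by
    rw [Category.assoc, ← Functor.map_comp_assoc, ← Functor.map_comp_assoc, φ.unit_onTarget,
      φ.act_onTarget, Functor.map_comp_assoc, ← B.assoc]
    exact T.μ.naturality_assoc _ _)
  act_onTarget := coequalizer.π_desc _ _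

/-- The free algebra sequence on a partial algebra. -/
noncomputable def iter (P : PartialAlgebra T) : ℕ → PartialAlgebra T
  | 0 => P
  | n + 1 => (iter P n).next

instance (P : PartialAlgebra T) [Epi P.act] : ∀ n, Epi (P.iter n).act
  | 0 => inferInstanceAs (Epi P.act)
  | n + 1 => inferInstanceAs (Epi (P.iter n).nextAct)

/-- The extension of a morphism to the free algebra sequence. -/
noncomputable def Hom.iter {P : PartialAlgebra T} {B : T.Algebra} (φ : P.Hom B) :
    ∀ n, (P.iter n).Hom B
  | 0 => φ
  | n + 1 => (Hom.iter φ n).next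

/-- The diagram of the underlying objects of the free algebra sequence. -/
noncomputable def diagram (P : PartialAlgebra T) : ℕ ⥤ C :=
  Functor.ofSequence (X := fun n => (P.iter n).source) fun n => (P.iter n).unit

lemma diagram_map_succ (P : PartialAlgebra T) (n : ℕ) :
    P.diagram.map (homOfLE (n.le_add_right 1)) = (P.iter n).unit :=
  Functor.ofSequence_map_homOfLE_succ _ n

end Next

section Free

variable [HasCoequalizers C] [HasColimitsOfShape ℕ C]

/-- The underlying object of the free algebra on a partial algebra. -/
noncomputable def freeObj (P : PartialAlgebra T) : C := colimit P.diagram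

/-- The map to the free algebra from the source of a term of the free algebra sequence. -/
noncomputable def ofSource (P : PartialAlgebra T) (n : ℕ) : (P.iter n).source ⟶ P.freeObj :=
  colimit.ι P.diagram n

/-- The map to the free algebra from the target of a term of the free algebra sequence. -/
noncomputable def ofTarget (P : PartialAlgebra T) (n : ℕ) : (P.iter n).target ⟶ P.freeObj :=
  P.ofSource (n + 1)

lemma unit_ofTarget (P : PartialAlgebra T) (n : ℕ) :
    (P.iter n).unit ≫ P.ofTarget n = P.ofSource n := by
  rw [← diagram_map_succ]
  exact colimit.w P.diagram _

lemma freeObj_hom_ext {P : PartialAlgebra T} {Z : C} {f g : P.freeObj ⟶ Z}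
    (h : ∀ n, P.ofSource n ≫ f = P.ofSource n ≫ g) : f = g :=
  colimit.hom_ext h

lemma exists_freeObj_desc (P : PartialAlgebra T) {B : T.Algebra} (φ : P.Hom B) :
    ∃ d : P.freeObj ⟶ B.A, (∀ n, P.ofSource n ≫ d = (φ.iter n).onSource) ∧
      ∀ n, P.ofTarget n ≫ d = (φ.iter n).onTarget :=
  ⟨colimit.desc P.diagram ⟨B.A, NatTrans.ofSequence (fun n => (φ.iter n).onSource) fun n => by
      rw [diagram_map_succ]
      exact ((φ.iter n).unit_onTarget).trans (Category.comp_id _).symm⟩,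
    fun n => colimit.ι_desc _ n, fun n => colimit.ι_desc _ (n + 1)⟩

lemma map_unit_act_ofTarget_succ (P : PartialAlgebra T) (n : ℕ) :
    T.map (P.iter n).unit ≫ (P.iter (n + 1)).act ≫ P.ofTarget (n + 1) =
      (P.iter n).act ≫ P.ofTarget n := by
  have h := (P.iter n).map_unit_nextAct =≫ P.ofTarget (n + 1)
  exact (Category.assoc _ _ _).symm.trans <| h.trans <| (Category.assoc _ _ _).trans
    ((P.iter n).act ≫= P.unit_ofTarget (n + 1))

variable [PreservesColimitsOfShape ℕ T.toFunctor]

lemma map_freeObj_hom_ext {P : PartialAlgebra T} {Z : C} {f g : T.obj P.freeObj ⟶ Z}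
    (h : ∀ n, T.map (P.ofSource n) ≫ f = T.map (P.ofSource n) ≫ g) : f = g :=
  (isColimitOfPreserves T.toFunctor (colimit.isColimit P.diagram)).hom_ext h

lemma map_map_freeObj_hom_ext {P : PartialAlgebra T} {Z : C}
    {f g : T.obj (T.obj P.freeObj) ⟶ Z}
    (h : ∀ n, T.map (T.map (P.ofSource n)) ≫ f = T.map (T.map (P.ofSource n)) ≫ g) : f = g :=
  (isColimitOfPreserves T.toFunctor
    (isColimitOfPreserves T.toFunctor (colimit.isColimit P.diagram))).hom_ext h

/-- The structure map of the free algebra on a partial algebra. -/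
noncomputable def freeAct (P : PartialAlgebra T) : T.obj P.freeObj ⟶ P.freeObj :=
  (isColimitOfPreserves T.toFunctor (colimit.isColimit P.diagram)).desc
    ⟨P.freeObj, NatTrans.ofSequence (fun n => (P.iter n).act ≫ P.ofTarget n) fun n => by
      rw [Functor.comp_map, diagram_map_succ]
      exact (P.map_unit_act_ofTarget_succ n).trans (Category.comp_id _).symm⟩

lemma map_ofSource_freeAct (P : PartialAlgebra T) (n : ℕ) :
    T.map (P.ofSource n) ≫ P.freeAct = (P.iter n).act ≫ P.ofTarget n :=
  (isColimitOfPreserves T.toFunctor (colimit.isColimit P.diagram)).fac _ n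

lemma map_ofTarget_freeAct (P : PartialAlgebra T) (n : ℕ) :
    T.map (P.ofTarget n) ≫ P.freeAct = (P.iter n).nextAct ≫ P.ofTarget (n + 1) :=
  P.map_ofSource_freeAct (n + 1)

lemma map_act_map_ofTarget_freeAct (P : PartialAlgebra T) (n : ℕ) :
    T.map (P.iter n).act ≫ T.map (P.ofTarget n) ≫ P.freeAct =
      T.μ.app _ ≫ T.map (P.ofSource n) ≫ P.freeAct := by
  have h := (P.iter n).map_act_nextAct =≫ P.ofTarget (n + 1)
  rw [← P.unit_ofTarget n, Functor.map_comp_assoc, map_ofTarget_freeAct]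
  exact (Category.assoc _ _ _).symm.trans <| h.trans <| (Category.assoc _ _ _).trans
    (_ ≫= Category.assoc _ _ _)

/-- The free algebra on a partial algebra. -/
noncomputable def free (P : PartialAlgebra T) : T.Algebra where
  A := P.freeObj
  a := P.freeAct
  unit := freeObj_hom_ext fun n => by
    rw [T.unit_naturality_assoc, map_ofSource_freeAct, Category.comp_id, ← P.unit_ofTarget n,
      unit, Category.assoc]
  assoc := map_map_freeObj_hom_ext fun n => by
    have h := T.μ.naturality_assoc (P.ofSource n) P.freeAct
    refine Eq.trans h ?_
    rw [← map_act_map_ofTarget_freeAct, ← Functor.map_comp_assoc, ← Functor.map_comp_assoc,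
      map_ofSource_freeAct]

lemma act_ofTarget_hom (P : PartialAlgebra T) {B : T.Algebra} {k : P.freeObj ⟶ B.A}
    (h : T.map k ≫ B.a = P.freeAct ≫ k) (n : ℕ) :
    (P.iter n).act ≫ P.ofTarget n ≫ k = T.map (P.ofSource n ≫ k) ≫ B.a := by
  rw [Functor.map_comp_assoc, h, ← Category.assoc (T.map _), map_ofSource_freeAct, Category.assoc]

lemma free_hom_ext {P : PartialAlgebra T} [Epi P.act] {B : T.Algebra} {f g : P.free ⟶ B}
    (h : P.ofSource 0 ≫ f.f = P.ofSource 0 ≫ g.f) : f = g := by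
  ext
  refine freeObj_hom_ext fun n => ?_
  induction n with
  | zero => exact h
  | succ n ih =>
    refine (cancel_epi (P.iter n).act).1 ?_
    refine (P.act_ofTarget_hom f.h n).trans (Eq.trans ?_ (P.act_ofTarget_hom g.h n).symm)
    exact congrArg (fun k => T.map k ≫ B.a) ih

lemma exists_free_desc (P : PartialAlgebra T) {B : T.Algebra} (φ : P.Hom B) :
    ∃ d : P.free ⟶ B, P.ofSource 0 ≫ d.f = φ.onSource := by
  obtain ⟨d, hs, ht⟩ := P.exists_freeObj_desc φ
  have h : T.map d ≫ B.a = P.freeAct ≫ d := map_freeObj_hom_ext fun n => by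
    rw [← Functor.map_comp_assoc, hs, ← Category.assoc (T.map _), map_ofSource_freeAct,
      Category.assoc, ht, Hom.act_onTarget]
  exact ⟨⟨d, h⟩, hs 0⟩

end Free

end PartialAlgebra

section Colimits

variable {J : Type*} [Category* J] [HasColimitsOfShape J C]

/-- The coprojections to the colimit of the underlying objects of a diagram of algebras. -/
noncomputable def coproj (D : J ⥤ T.Algebra) (j : J) :
    (D.obj j).A ⟶ colimit (D ⋙ T.forget) :=
  colimit.ι (D ⋙ T.forget) j

lemma coproj_w (D : J ⥤ T.Algebra) {i j : J} (f : i ⟶ j) :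
    (D.map f).f ≫ coproj D j = coproj D i :=
  colimit.w (D ⋙ T.forget) f

lemma exists_coproj_desc {D : J ⥤ T.Algebra} (s : Cocone D) :
    ∃ d : colimit (D ⋙ T.forget) ⟶ s.pt.A, ∀ j, coproj D j ≫ d = (s.ι.app j).f :=
  ⟨colimit.desc (D ⋙ T.forget) (T.forget.mapCocone s),
    colimit.ι_desc (T.forget.mapCocone s)⟩

variable [HasCoequalizers C] [HasCoproductsOfShape J C]

/-- The partial algebra whose free algebra is the colimit of a diagram of algebras: it acts on the
colimit of the underlying objects, with values in the quotient which makes the coprojections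
compatible with the actions. -/
noncomputable def colimitPartialAlgebra (D : J ⥤ T.Algebra) : PartialAlgebra T where
  source := colimit (D ⋙ T.forget)
  target := coequalizer
    (Limits.Sigma.desc fun j => T.map (coproj D j))
    (Limits.Sigma.desc fun j => (D.obj j).a ≫ coproj D j ≫ T.η.app _)
  act := coequalizer.π _ _

instance (D : J ⥤ T.Algebra) : Epi (colimitPartialAlgebra D).act :=
  coequalizer.π_epi (f := Limits.Sigma.desc fun j => T.map (coproj D j))

/-- The coprojections to the source of `colimitPartialAlgebra D`. -/
noncomputable def toColimitPartialAlgebra (D : J ⥤ T.Algebra) (j : J) :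
    (D.obj j).A ⟶ (colimitPartialAlgebra D).source :=
  coproj D j

lemma map_toColimitPartialAlgebra_act (D : J ⥤ T.Algebra) (j : J) :
    T.map (toColimitPartialAlgebra D j) ≫ (colimitPartialAlgebra D).act =
      (D.obj j).a ≫ toColimitPartialAlgebra D j ≫ (colimitPartialAlgebra D).unit := by
  have h := Limits.Sigma.ι (fun j => T.obj (D.obj j).A) j ≫= coequalizer.condition
    (Limits.Sigma.desc fun j => T.map (coproj D j))
    (Limits.Sigma.desc fun j => (D.obj j).a ≫ coproj D j ≫ T.η.app _)
  rw [Sigma.ι_desc_assoc, Sigma.ι_desc_assoc, Category.assoc, Category.assoc] at h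
  exact h

/-- A cocone over a diagram of algebras gives a morphism from the associated partial algebra. -/
lemma exists_colimitPartialAlgebra_hom {D : J ⥤ T.Algebra} (s : Cocone D) :
    ∃ φ : (colimitPartialAlgebra D).Hom s.pt,
      ∀ j, toColimitPartialAlgebra D j ≫ φ.onSource = (s.ι.app j).f := by
  obtain ⟨d, hd⟩ := exists_coproj_desc s
  refine ⟨⟨d, coequalizer.desc (T.map d ≫ s.pt.a) ?_, coequalizer.π_desc _ _⟩, hd⟩
  refine Sigma.hom_ext _ _ fun j => ?_
  rw [Sigma.ι_desc_assoc, Sigma.ι_desc_assoc, ← Functor.map_comp_assoc, Category.assoc,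
    Category.assoc, hd]
  have h : T.η.app _ ≫ T.map d ≫ s.pt.a = d :=
    (T.η.naturality_assoc d s.pt.a).symm.trans <|
      (d ≫= s.pt.unit).trans (Category.comp_id d)
  exact (s.ι.app j).h.trans <| (D.obj j).a ≫= ((_ ≫= h).trans (hd j)).symm

variable [HasColimitsOfShape ℕ C] [PreservesColimitsOfShape ℕ T.toFunctor]

/-- The coprojections to the underlying object of the colimit of a diagram of algebras. -/
noncomputable def toFree (D : J ⥤ T.Algebra) (j : J) :
    (D.obj j).A ⟶ (colimitPartialAlgebra D).freeObj :=
  toColimitPartialAlgebra D j ≫ (colimitPartialAlgebra D).ofSource 0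

/-- The colimit cocone over a diagram of algebras. -/
noncomputable def colimitCocone (D : J ⥤ T.Algebra) : Cocone D where
  pt := (colimitPartialAlgebra D).free
  ι :=
    { app := fun j =>
        { f := toFree D j
          h := by
            have h := map_toColimitPartialAlgebra_act D j =≫ (colimitPartialAlgebra D).ofTarget 0
            refine Eq.trans ?_ (h.trans ?_)
            · exact (T.map_comp_assoc _ _ _).trans <|
                (_ ≫= (colimitPartialAlgebra D).map_ofSource_freeAct 0).trans
                  (Category.assoc _ _ _).symm
            · exact (Category.assoc _ _ _).trans <| (D.obj j).a ≫= (Category.assoc _ _ _).trans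
                (_ ≫= (colimitPartialAlgebra D).unit_ofTarget 0) }
      naturality := fun i j f => by
        ext
        have h := coproj_w D f =≫ (colimitPartialAlgebra D).ofSource 0
        exact (Category.assoc _ _ _).symm.trans (h.trans (Category.comp_id _).symm) }

lemma hasColimit_of_preservesColimitsOfShape_nat (D : J ⥤ T.Algebra) : HasColimit D := by
  choose φ hφ using fun s : Cocone D => exists_colimitPartialAlgebra_hom s
  choose d hd using fun s : Cocone D => (colimitPartialAlgebra D).exists_free_desc (φ s)
  refine ⟨⟨⟨colimitCocone D, ⟨d, fun s j => ?_, fun s m hm => ?_⟩⟩⟩⟩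
  · ext
    exact ((Category.assoc _ _ _).trans (toColimitPartialAlgebra D j ≫= hd s)).trans (hφ s j)
  · refine PartialAlgebra.free_hom_ext (Eq.trans ?_ (hd s).symm)
    refine colimit.hom_ext fun j => Eq.trans ?_ (hφ s j).symm
    exact (Category.assoc _ _ _).symm.trans (congrArg Algebra.Hom.f (hm j))

end Colimits

end CategoryTheory.Monad

/-- If `C` is a complete and cocomplete category and `T` is a monad on `C` whose
underlying endofunctor preserves filtered colimits (i.e. `T` is finitary), then the
Eilenberg–Moore category of `T`-algebras is complete and cocomplete. -/
theorem stmt11 {C : Type*} [Category C] [HasLimits C] [HasColimits C]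
    (T : Monad C) [PreservesFilteredColimits T.toFunctor] :
    HasLimits T.Algebra ∧ HasColimits T.Algebra := by
  have := preservesSmallestFilteredColimits_of_preservesFilteredColimits T.toFunctor
  have : PreservesColimitsOfShape ℕ T.toFunctor :=
    PreservesFilteredColimitsOfSize.preserves_filtered_colimits ℕ
  exact ⟨⟨fun _ _ => ⟨fun D => Monad.hasLimit_of_comp_forget_hasLimit D⟩⟩,
    ⟨fun _ _ => ⟨fun D => Monad.hasColimit_of_preservesColimitsOfShape_nat D⟩⟩⟩
end
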